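/- arXiv:2210.06414 — 5 statements merged into one kernel-verified Lean document; each statement's English description precedes it below -/
import Mathlib

section
/- Let n ≥ 1, s ∈ (1/2,1), C_s > 0 and ε > 0. If φ: ℝⁿ → ℝ is bounded and continuous, then the function x ↦ L_ε[φ](x) is bounded and continuous on ℝⁿ, and sup_{x∈ℝⁿ} |L_ε[φ](x)| ≤ (2 C_s / s) ε^{−2s} sup_{x∈ℝⁿ}|φ(x)|. -/
open MeasureTheory Metric Set

noncomputable section

abbrev E (n : ℕ) : Type := EuclideanSpace ℝ (Fin n)

/-- The truncated infinity fractional Laplacian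
`L_ε[φ](x) = C_s ⋅ sup_{|y|=1} inf_{|ŷ|=1} ∫_ε^∞ (φ(x+ηy)+φ(x−ηŷ)−2φ(x)) η^{−1−2s} dη`. -/
def iflTrunc (n : ℕ) (s Cs ε : ℝ) (φ : E n → ℝ) (x : E n) : ℝ :=
  Cs * ⨆ y : {y : E n // ‖y‖ = 1}, ⨅ yt : {y : E n // ‖y‖ = 1},
    ∫ η in Ioi ε,
      (φ (x + η • (y : E n)) + φ (x - η • (yt : E n)) - 2 * φ x) / η ^ (1 + 2*s)

theorem integrableOn_const_div_rpow {s ε : ℝ} (hs : 0 < s) (hε : 0 < ε) (c : ℝ) :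
    IntegrableOn (fun η : ℝ => c / η ^ (1 + 2 * s)) (Ioi ε) := by
  refine IntegrableOn.congr_fun (f := fun η : ℝ => c * η ^ (-(1 + 2 * s)))
    ((integrableOn_Ioi_rpow_of_lt (by linarith) hε).const_mul c) (fun η hη => ?_) measurableSet_Ioi
  simp only [Real.rpow_neg (hε.trans hη).le, div_eq_mul_inv]

theorem setIntegral_const_div_rpow {s ε : ℝ} (hs : 0 < s) (hε : 0 < ε) (c : ℝ) :
    ∫ η in Ioi ε, c / η ^ (1 + 2 * s) = c / (2 * s) * ε ^ (-(2 * s)) := by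
  have h : ∫ η in Ioi ε, c / η ^ (1 + 2 * s) = ∫ η in Ioi ε, c * η ^ (-(1 + 2 * s)) :=
    setIntegral_congr_fun measurableSet_Ioi fun η hη => by
      simp only [Real.rpow_neg (hε.trans hη).le, div_eq_mul_inv]
  rw [h, integral_const_mul, integral_Ioi_rpow_of_lt (by linarith) hε,
    show -(1 + 2 * s) + 1 = -(2 * s) by ring]
  field_simp

theorem abs_add_sub_two_mul_le {a b c M : ℝ} (ha : |a| ≤ M) (hb : |b| ≤ M) (hc : |c| ≤ M) :
    |a + b - 2 * c| ≤ 4 * M := by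
  rw [abs_le] at *
  constructor <;> linarith

theorem norm_secondDifference_div_rpow_le {n : ℕ} {s ε M : ℝ} {φ : E n → ℝ} (hε : 0 < ε)
    (hφb : ∀ z, |φ z| ≤ M) (x y z : E n) {η : ℝ} (hη : η ∈ Ioi ε) :
    ‖(φ (x + η • y) + φ (x - η • z) - 2 * φ x) / η ^ (1 + 2 * s)‖ ≤
      4 * M / η ^ (1 + 2 * s) := by
  have hp : 0 < η ^ (1 + 2 * s) := Real.rpow_pos_of_pos (hε.trans hη) _
  rw [norm_div, Real.norm_eq_abs, Real.norm_of_nonneg hp.le]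
  gcongr
  exact abs_add_sub_two_mul_le (hφb _) (hφb _) (hφb _)

theorem abs_setIntegral_secondDifference_le {n : ℕ} {s ε M : ℝ} {φ : E n → ℝ} (hs : 0 < s)
    (hε : 0 < ε) (hφb : ∀ z, |φ z| ≤ M) (x y z : E n) :
    |∫ η in Ioi ε, (φ (x + η • y) + φ (x - η • z) - 2 * φ x) / η ^ (1 + 2 * s)| ≤
      2 / s * ε ^ (-(2 * s)) * M := by
  calc _ ≤ ∫ η in Ioi ε, 4 * M / η ^ (1 + 2 * s) :=
        norm_integral_le_of_norm_le (integrableOn_const_div_rpow hs hε _)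
          (ae_restrict_of_forall_mem measurableSet_Ioi fun η hη =>
            norm_secondDifference_div_rpow_le hε hφb x y z hη)
    _ = 2 / s * ε ^ (-(2 * s)) * M := by
        rw [setIntegral_const_div_rpow hs hε]
        field_simp
        ring

theorem continuous_setIntegral_secondDifference {n : ℕ} {s ε M : ℝ} {φ : E n → ℝ} (hs : 0 < s)
    (hε : 0 < ε) (hφc : Continuous φ) (hφb : ∀ z, |φ z| ≤ M) :
    Continuous fun p : E n × E n × E n => ∫ η in Ioi ε,
      (φ (p.1 + η • p.2.1) + φ (p.1 - η • p.2.2) - 2 * φ p.1) / η ^ (1 + 2 * s) := by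
  refine continuous_of_dominated (bound := fun η => 4 * M / η ^ (1 + 2 * s)) (fun p => ?_)
    (fun p => ?_) (integrableOn_const_div_rpow hs hε _) (Filter.Eventually.of_forall fun η => ?_)
  · refine Measurable.aestronglyMeasurable (Measurable.div ?_ (by fun_prop))
    exact Continuous.measurable (by fun_prop)
  · exact ae_restrict_of_forall_mem measurableSet_Ioi fun η hη =>
      norm_secondDifference_div_rpow_le hε hφb _ _ _ hη
  · exact Continuous.div_const (by fun_prop) _

theorem Continuous.iSup_of_compactSpace {X Y : Type*} [TopologicalSpace X] [TopologicalSpace Y]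
    [CompactSpace Y] {f : X → Y → ℝ} (hf : Continuous fun p : X × Y => f p.1 p.2) :
    Continuous fun x => ⨆ y, f x y := by
  simpa only [image_univ, sSup_range] using (isCompact_univ (X := Y)).continuous_sSup (f := f) hf

theorem Continuous.iInf_of_compactSpace {X Y : Type*} [TopologicalSpace X] [TopologicalSpace Y]
    [CompactSpace Y] {f : X → Y → ℝ} (hf : Continuous fun p : X × Y => f p.1 p.2) :
    Continuous fun x => ⨅ y, f x y := by
  simpa only [image_univ, sInf_range] using (isCompact_univ (X := Y)).continuous_sInf (f := f) hf

theorem abs_ciSup_le {ι : Type*} [Nonempty ι] {f : ι → ℝ} {B : ℝ} (h : ∀ i, |f i| ≤ B) :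
    |⨆ i, f i| ≤ B := by
  obtain ⟨i⟩ := ‹Nonempty ι›
  refine abs_le.2 ⟨(abs_le.1 (h i)).1.trans (le_ciSup ⟨B, ?_⟩ i),
    ciSup_le fun j => (abs_le.1 (h j)).2⟩
  rintro _ ⟨j, rfl⟩
  exact (abs_le.1 (h j)).2

theorem abs_ciInf_le {ι : Type*} [Nonempty ι] {f : ι → ℝ} {B : ℝ} (h : ∀ i, |f i| ≤ B) :
    |⨅ i, f i| ≤ B := by
  obtain ⟨i⟩ := ‹Nonempty ι›
  refine abs_le.2 ⟨le_ciInf fun j => (abs_le.1 (h j)).1,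
    (ciInf_le ⟨-B, ?_⟩ i).trans (abs_le.1 (h i)).2⟩
  rintro _ ⟨j, rfl⟩
  exact (abs_le.1 (h j)).1

/-- for bounded continuous φ, `L_ε[φ]` is bounded and continuous, with
`sup_x |L_ε[φ](x)| ≤ (2 C_s / s) ε^{−2s} sup_x |φ(x)|`. -/
theorem iflTrunc_bounded_continuous
    (n : ℕ) (hn : 1 ≤ n) (s Cs : ℝ) (hs : s ∈ Ioo (1/2 : ℝ) 1) (hCs : 0 < Cs)
    (ε : ℝ) (hε : 0 < ε) (φ : E n → ℝ) (hφc : Continuous φ)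
    (M : ℝ) (hφb : ∀ z, |φ z| ≤ M) :
    Continuous (fun x => iflTrunc n s Cs ε φ x) ∧
    (∀ x, |iflTrunc n s Cs ε φ x| ≤ (2 * Cs / s) * ε ^ (-(2*s)) * M) := by
  have hs0 : 0 < s := by linarith [hs.1]
  have : CompactSpace {y : E n // ‖y‖ = 1} := by
    refine (isCompact_iff_compactSpace (s := {y : E n | ‖y‖ = 1})).1 ?_
    have h : {y : E n | ‖y‖ = 1} = sphere 0 1 := by
      ext y
      simp
    exact h ▸ isCompact_sphere 0 1
  have : Nonempty {y : E n // ‖y‖ = 1} :=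
    ⟨⟨EuclideanSpace.single ⟨0, hn⟩ 1, by simp⟩⟩
  constructor
  · refine continuous_const.mul (Continuous.iSup_of_compactSpace ?_)
    refine Continuous.iInf_of_compactSpace
      (X := E n × {y : E n // ‖y‖ = 1}) (Y := {y : E n // ‖y‖ = 1})
      (f := fun p z => ∫ η in Ioi ε,
        (φ (p.1 + η • (p.2 : E n)) + φ (p.1 - η • (z : E n)) - 2 * φ p.1) / η ^ (1 + 2 * s)) ?_
    exact (continuous_setIntegral_secondDifference hs0 hε hφc hφb).comp
      (f := fun q : (E n × {y : E n // ‖y‖ = 1}) × {y : E n // ‖y‖ = 1} =>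
        (q.1.1, (q.1.2 : E n), (q.2 : E n))) (by fun_prop)
  · intro x
    rw [iflTrunc, abs_mul, abs_of_pos hCs]
    calc _ ≤ Cs * (2 / s * ε ^ (-(2 * s)) * M) :=
          mul_le_mul_of_nonneg_left (abs_ciSup_le fun y : {y : E n // ‖y‖ = 1} =>
            abs_ciInf_le fun z : {y : E n // ‖y‖ = 1} =>
            abs_setIntegral_secondDifference_le hs0 hε hφb x y z) hCs.le
      _ = 2 * Cs / s * ε ^ (-(2 * s)) * M := by ring
end
end

section
/- Let n ≥ 1, s ∈ (1/2,1), C_s > 0, ε, τ > 0 with τ ≤ s ε^{2s}/C_s, and let u₀: ℝⁿ → ℝ be bounded and uniformly continuous. Let (U^j)_{j∈ℕ} be the solution of the semi-discrete scheme U⁰ = u₀, U^{j+1} = U^j + τ L_ε[U^j]. Then for every j ∈ ℕ, inf_{ℝⁿ} u₀ ≤ U^j(x) ≤ sup_{ℝⁿ} u₀ for all x, and in particular sup_{x∈ℝⁿ}|U^j(x)| ≤ sup_{x∈ℝⁿ}|u₀(x)|. -/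
open MeasureTheory Metric Set

noncomputable section

/-- No measurability is needed: the Bochner integral of a non-integrable function is `0`. -/
theorem setIntegral_Ioi_div_rpow_le {s ε K : ℝ} (hs : 0 < s) (hε : 0 < ε) (hK : 0 ≤ K)
    {f : ℝ → ℝ} (hf : ∀ η, f η ≤ K) :
    ∫ η in Ioi ε, f η / η ^ (1 + 2*s) ≤ K * (ε ^ (-(2*s)) / (2*s)) := by
  by_cases hi : IntegrableOn (fun η => f η / η ^ (1 + 2*s)) (Ioi ε)
  · have hlt : -(1 + 2*s) < -1 := by linarith
    have hint := (integrableOn_Ioi_rpow_of_lt hlt hε).const_mul K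
    calc ∫ η in Ioi ε, f η / η ^ (1 + 2*s)
        ≤ ∫ η in Ioi ε, K * η ^ (-(1 + 2*s)) := by
          refine setIntegral_mono_on hi hint measurableSet_Ioi fun η hη => ?_
          have hη0 : 0 < η := hε.trans hη
          rw [Real.rpow_neg hη0.le, ← div_eq_mul_inv]
          gcongr
          exact hf η
      _ = K * (ε ^ (-(2*s)) / (2*s)) := by
          rw [integral_const_mul, integral_Ioi_rpow_of_lt hlt hε,
            show -(1 + 2*s) + 1 = -(2*s) by ring, neg_div_neg_eq]
  · rw [integral_undef hi]
    positivity

theorem le_setIntegral_Ioi_div_rpow {s ε K : ℝ} (hs : 0 < s) (hε : 0 < ε) (hK : 0 ≤ K)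
    {f : ℝ → ℝ} (hf : ∀ η, -K ≤ f η) :
    -(K * (ε ^ (-(2*s)) / (2*s))) ≤ ∫ η in Ioi ε, f η / η ^ (1 + 2*s) := by
  have h := setIntegral_Ioi_div_rpow_le hs hε hK (f := fun η => -f η)
    fun η => by linarith [hf η]
  simp only [neg_div, integral_neg] at h
  linarith

theorem ciSup_ciInf_mem_Icc {ι κ : Type*} [Nonempty ι] [Nonempty κ] {F : ι → κ → ℝ} {a b : ℝ}
    (h : ∀ i k, F i k ∈ Icc a b) : (⨆ i, ⨅ k, F i k) ∈ Icc a b := by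
  have hinf : ∀ i, (⨅ k, F i k) ∈ Icc a b := fun i =>
    ⟨le_ciInf fun k => (h i k).1,
      ciInf_le_of_le ⟨a, forall_mem_range.2 fun k => (h i k).1⟩ (Classical.arbitrary κ) (h i _).2⟩
  exact ⟨le_ciSup_of_le ⟨b, forall_mem_range.2 fun i => (hinf i).2⟩ (Classical.arbitrary ι)
    (hinf _).1, ciSup_le fun i => (hinf i).2⟩

theorem iflTrunc_mem_Icc {n : ℕ} (hn : 1 ≤ n) {s Cs ε m M : ℝ} (hs : 0 < s) (hCs : 0 < Cs)
    (hε : 0 < ε) {φ : E n → ℝ} (hφ : ∀ z, φ z ∈ Icc m M) (x : E n) :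
    iflTrunc n s Cs ε φ x ∈
      Icc (-(Cs * ((φ x - m) * (ε ^ (-(2*s)) / s)))) (Cs * ((M - φ x) * (ε ^ (-(2*s)) / s))) := by
  have : Nonempty (Fin n) := ⟨⟨0, hn⟩⟩
  have : Nonempty {y : E n // ‖y‖ = 1} :=
    (exists_norm_eq (E n) zero_le_one).elim fun y hy => ⟨⟨y, hy⟩⟩
  have hhalf : ∀ c : ℝ, 2 * c * (ε ^ (-(2*s)) / (2*s)) = c * (ε ^ (-(2*s)) / s) := fun c => by
    field_simp
  have key := ciSup_ciInf_mem_Icc (a := -((φ x - m) * (ε ^ (-(2*s)) / s)))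
    (b := (M - φ x) * (ε ^ (-(2*s)) / s))
    (F := fun y yt : {y : E n // ‖y‖ = 1} => ∫ η in Ioi ε,
      (φ (x + η • (y : E n)) + φ (x - η • (yt : E n)) - 2 * φ x) / η ^ (1 + 2*s))
    fun y yt => by
      have hx := hφ x
      constructor
      · rw [← hhalf]
        refine le_setIntegral_Ioi_div_rpow hs hε (by linarith [hx.1]) fun η => ?_
        linarith [(hφ (x + η • (y : E n))).1, (hφ (x - η • (yt : E n))).1]
      · rw [← hhalf]
        refine setIntegral_Ioi_div_rpow_le hs hε (by linarith [hx.2]) fun η => ?_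
        linarith [(hφ (x + η • (y : E n))).2, (hφ (x - η • (yt : E n))).2]
  unfold iflTrunc
  rw [← mul_neg]
  exact ⟨mul_le_mul_of_nonneg_left key.1 hCs.le, mul_le_mul_of_nonneg_left key.2 hCs.le⟩

theorem add_mul_iflTrunc_mem_Icc {n : ℕ} (hn : 1 ≤ n) {s Cs ε τ m M : ℝ} (hs : 0 < s)
    (hCs : 0 < Cs) (hε : 0 < ε) (hτ : 0 ≤ τ) (hCFL : τ ≤ s * ε ^ (2*s) / Cs)
    {φ : E n → ℝ} (hφ : ∀ z, φ z ∈ Icc m M) (x : E n) :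
    φ x + τ * iflTrunc n s Cs ε φ x ∈ Icc m M := by
  obtain ⟨h1, h2⟩ := iflTrunc_mem_Icc hn hs hCs hε hφ x
  obtain ⟨hm, hM⟩ := hφ x
  have hA : τ * (Cs * (ε ^ (-(2*s)) / s)) ≤ 1 := by
    have hpos : 0 < ε ^ (2*s) := Real.rpow_pos_of_pos hε _
    rw [Real.rpow_neg hε.le]
    calc τ * (Cs * ((ε ^ (2*s))⁻¹ / s))
        ≤ s * ε ^ (2*s) / Cs * (Cs * ((ε ^ (2*s))⁻¹ / s)) := by gcongr
      _ = 1 := by field_simp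
  have h3 := mul_le_mul_of_nonneg_left h1 hτ
  have h4 := mul_le_mul_of_nonneg_left h2 hτ
  have h5 := mul_le_mul_of_nonneg_right hA (sub_nonneg.2 hm)
  have h6 := mul_le_mul_of_nonneg_right hA (sub_nonneg.2 hM)
  constructor <;> linarith

/-- under the CFL condition τ ≤ s ε^{2s}/C_s, the solution of the semi-discrete
scheme `U⁰ = u₀`, `U^{j+1} = U^j + τ L_ε[U^j]` satisfies
`inf u₀ ≤ U^j ≤ sup u₀` and hence `sup |U^j| ≤ sup |u₀|`. -/
theorem scheme_Cb_stability
    (n : ℕ) (hn : 1 ≤ n) (s Cs : ℝ) (hs : s ∈ Ioo (1/2 : ℝ) 1) (hCs : 0 < Cs)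
    (ε τ : ℝ) (hε : 0 < ε) (hτ : 0 < τ) (hCFL : τ ≤ s * ε ^ (2*s) / Cs)
    (u₀ : E n → ℝ) (hb : ∃ M, ∀ z, |u₀ z| ≤ M) (huc : UniformContinuous u₀)
    (U : ℕ → E n → ℝ) (hU0 : U 0 = u₀)
    (hUrec : ∀ j x, U (j+1) x = U j x + τ * iflTrunc n s Cs ε (U j) x) :
    (∀ j x, (⨅ z, u₀ z) ≤ U j x ∧ U j x ≤ ⨆ z, u₀ z) ∧
    (∀ j x, |U j x| ≤ ⨆ z, |u₀ z|) := by
  obtain ⟨B, hB⟩ := hb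
  have hbelow : BddBelow (range u₀) := ⟨-B, forall_mem_range.2 fun z => (abs_le.1 (hB z)).1⟩
  have habove : BddAbove (range u₀) := ⟨B, forall_mem_range.2 fun z => (abs_le.1 (hB z)).2⟩
  have habs : BddAbove (range fun z => |u₀ z|) := ⟨B, forall_mem_range.2 hB⟩
  have hs0 : 0 < s := by linarith [hs.1]
  have stable : ∀ m M : ℝ, (∀ z, u₀ z ∈ Icc m M) → ∀ j x, U j x ∈ Icc m M := by
    intro m M h j
    induction j with
    | zero => simpa [hU0] using h
    | succ j ih =>
      intro x
      rw [hUrec]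
      exact add_mul_iflTrunc_mem_Icc hn hs0 hCs hε hτ.le hCFL ih x
  refine ⟨fun j x => stable _ _ (fun z => ⟨ciInf_le hbelow z, le_ciSup habove z⟩) j x,
    fun j x => abs_le.2 (stable _ _ (fun z => abs_le.1 (le_ciSup habs z)) j x)⟩
end
end

section
/- Let n ≥ 1, s ∈ (1/2,1), C_s > 0, ε, τ > 0 with τ ≤ s ε^{2s}/C_s. Let u₀, v₀: ℝⁿ → ℝ be bounded and uniformly continuous, and let (U^j) and (V^j) be sequences of bounded continuous functions with U⁰ = u₀, V⁰ = v₀, satisfying U^{j+1} ≤ U^j + τ L_ε[U^j] (subsolution) and V^{j+1} ≥ V^j + τ L_ε[V^j] (supersolution) pointwise for all j ∈ ℕ. If u₀ ≤ v₀ on ℝⁿ, then U^j ≤ V^j on ℝⁿ for every j ∈ ℕ. -/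
open MeasureTheory Metric Set

noncomputable section

lemma iSup_iInf_le_iSup_iInf_add {ι κ : Type*} [Nonempty ι] [Nonempty κ] {F G : ι → κ → ℝ}
    {A B c : ℝ} (hF : ∀ i k, |F i k| ≤ A) (hG : ∀ i k, |G i k| ≤ B)
    (h : ∀ i k, F i k ≤ G i k + c) :
    ⨆ i, ⨅ k, F i k ≤ (⨆ i, ⨅ k, G i k) + c := by
  have bddF (i : ι) : BddBelow (range (F i)) :=
    ⟨-A, by rintro _ ⟨k, rfl⟩; exact (abs_le.1 (hF i k)).1⟩
  have bddG (i : ι) : BddBelow (range (G i)) :=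
    ⟨-B, by rintro _ ⟨k, rfl⟩; exact (abs_le.1 (hG i k)).1⟩
  have bddG' : BddAbove (range fun i => ⨅ k, G i k) := by
    refine ⟨B, ?_⟩
    rintro _ ⟨i, rfl⟩
    exact (ciInf_le (bddG i) (Classical.arbitrary κ)).trans (abs_le.1 (hG i _)).2
  refine ciSup_le fun i => ?_
  have h₁ : (⨅ k, F i k) - c ≤ ⨅ k, G i k :=
    le_ciInf fun k => by linarith [ciInf_le (bddF i) k, h i k]
  linarith [le_ciSup bddG' i]

lemma integrableOn_div_rpow_of_bounded {r ε M : ℝ} (hr : 1 < r) (hε : 0 < ε) {f : ℝ → ℝ}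
    (hf : Continuous f) (hM : ∀ η, |f η| ≤ M) :
    IntegrableOn (fun η => f η / η ^ r) (Ioi ε) := by
  have hk : IntegrableOn (fun η : ℝ => η ^ (-r)) (Ioi ε) :=
    integrableOn_Ioi_rpow_of_lt (by linarith) hε
  have hfk : IntegrableOn (fun η : ℝ => f η * η ^ (-r)) (Ioi ε) :=
    hk.bdd_mul (c := M) hf.aestronglyMeasurable (Filter.Eventually.of_forall hM)
  refine hfk.congr_fun (fun η hη => ?_) measurableSet_Ioi
  simp only [Real.rpow_neg (hε.trans hη).le, div_eq_mul_inv]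

lemma abs_integral_div_rpow_le {r ε M : ℝ} (hr : 1 < r) (hε : 0 < ε) {f : ℝ → ℝ}
    (hM : ∀ η, |f η| ≤ M) :
    |∫ η in Ioi ε, f η / η ^ r| ≤ ∫ η in Ioi ε, M / η ^ r := by
  have hMi : IntegrableOn (fun η : ℝ => M / η ^ r) (Ioi ε) :=
    integrableOn_div_rpow_of_bounded hr hε continuous_const fun _ => le_rfl
  rw [← Real.norm_eq_abs]
  refine norm_integral_le_of_norm_le hMi ?_
  filter_upwards [ae_restrict_mem measurableSet_Ioi] with η hη
  have hη' : 0 < η ^ r := Real.rpow_pos_of_pos (hε.trans hη) _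
  rw [Real.norm_eq_abs, abs_div, abs_of_pos hη']
  exact div_le_div_of_nonneg_right (hM η) hη'.le

lemma integral_Ioi_const_div_rpow {s ε : ℝ} (hs : 0 < s) (hε : 0 < ε) (c : ℝ) :
    ∫ η in Ioi ε, c / η ^ (1 + 2 * s) = c * (ε ^ (2 * s))⁻¹ / (2 * s) := by
  have h : ∫ η in Ioi ε, c / η ^ (1 + 2 * s) = ∫ η in Ioi ε, c * η ^ (-(1 + 2 * s)) :=
    setIntegral_congr_fun measurableSet_Ioi fun η hη => by
      simp only [Real.rpow_neg (hε.trans hη).le, div_eq_mul_inv]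
  rw [h, integral_const_mul, integral_Ioi_rpow_of_lt (by linarith) hε,
    show -(1 + 2 * s) + 1 = -(2 * s) by ring, Real.rpow_neg hε.le]
  field_simp

lemma abs_second_difference_le {n : ℕ} {φ : E n → ℝ} {M : ℝ} (hM : ∀ z, |φ z| ≤ M)
    (x y z : E n) : |φ y + φ z - 2 * φ x| ≤ 4 * M := by
  have hx := abs_le.1 (hM x)
  have hy := abs_le.1 (hM y)
  have hz := abs_le.1 (hM z)
  exact abs_le.2 ⟨by linarith, by linarith⟩

/-- Under the CFL condition, one explicit Euler step of the truncated operator is monotone. -/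
lemma add_mul_iflTrunc_mono {n : ℕ} (hn : 1 ≤ n) {s Cs ε τ : ℝ} (hs : 0 < s) (hCs : 0 < Cs)
    (hε : 0 < ε) (hτ : 0 < τ) (hCFL : τ ≤ s * ε ^ (2 * s) / Cs) {φ ψ : E n → ℝ} {A B : ℝ}
    (hφb : ∀ z, |φ z| ≤ A) (hφ : Continuous φ) (hψb : ∀ z, |ψ z| ≤ B) (hψ : Continuous ψ)
    (h : ∀ z, φ z ≤ ψ z) (x : E n) :
    φ x + τ * iflTrunc n s Cs ε φ x ≤ ψ x + τ * iflTrunc n s Cs ε ψ x := by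
  have : Nonempty (Fin n) := ⟨⟨0, hn⟩⟩
  have : Nonempty {y : E n // ‖y‖ = 1} :=
    let ⟨y, hy⟩ := exists_norm_eq (E n) zero_le_one; ⟨⟨y, hy⟩⟩
  have hr : 1 < 1 + 2 * s := by linarith
  have hp : 0 < ε ^ (2 * s) := Real.rpow_pos_of_pos hε _
  set d : ℝ := 2 * (ψ x - φ x) with hd
  have hd0 : 0 ≤ d := by linarith [h x]
  have key := iSup_iInf_le_iSup_iInf_add
    (F := fun y yt : {y : E n // ‖y‖ = 1} => ∫ η in Ioi ε,
      (φ (x + η • (y : E n)) + φ (x - η • (yt : E n)) - 2 * φ x) / η ^ (1 + 2 * s))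
    (G := fun y yt : {y : E n // ‖y‖ = 1} => ∫ η in Ioi ε,
      (ψ (x + η • (y : E n)) + ψ (x - η • (yt : E n)) - 2 * ψ x) / η ^ (1 + 2 * s))
    (c := ∫ η in Ioi ε, d / η ^ (1 + 2 * s))
    (fun _ _ => abs_integral_div_rpow_le hr hε fun _ => abs_second_difference_le hφb ..)
    (fun _ _ => abs_integral_div_rpow_le hr hε fun _ => abs_second_difference_le hψb ..)
    (fun y yt => by
      have hFi := integrableOn_div_rpow_of_bounded hr hε
        (f := fun η => φ (x + η • (y : E n)) + φ (x - η • (yt : E n)) - 2 * φ x) (by fun_prop)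
        fun _ => abs_second_difference_le hφb ..
      have hGi := integrableOn_div_rpow_of_bounded hr hε
        (f := fun η => ψ (x + η • (y : E n)) + ψ (x - η • (yt : E n)) - 2 * ψ x) (by fun_prop)
        fun _ => abs_second_difference_le hψb ..
      have hdi := integrableOn_div_rpow_of_bounded hr hε (f := fun _ => d) continuous_const
        fun _ => le_rfl
      rw [← integral_add hGi hdi]
      refine setIntegral_mono_on hFi (hGi.add hdi) measurableSet_Ioi fun η hη => ?_
      rw [← add_div]
      refine div_le_div_of_nonneg_right ?_ (Real.rpow_nonneg (hε.trans hη).le _)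
      linarith [h (x + η • (y : E n)), h (x - η • (yt : E n))])
  rw [integral_Ioi_const_div_rpow hs hε] at key
  have hstep : τ * Cs * (d * (ε ^ (2 * s))⁻¹ / (2 * s)) ≤ ψ x - φ x := by
    calc τ * Cs * (d * (ε ^ (2 * s))⁻¹ / (2 * s))
        ≤ s * ε ^ (2 * s) * (d * (ε ^ (2 * s))⁻¹ / (2 * s)) :=
          mul_le_mul_of_nonneg_right ((le_div_iff₀ hCs).1 hCFL) (by positivity)
      _ = ψ x - φ x := by rw [hd]; field_simp
  have := mul_le_mul_of_nonneg_left key (mul_pos hτ hCs).le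
  simp only [iflTrunc, ← mul_assoc]
  linarith

/-- comparison principle for the semi-discrete scheme under the CFL condition:
if (U^j) is a subsolution and (V^j) a supersolution of the scheme, consisting of bounded
continuous functions, with ordered initial data u₀ ≤ v₀, then U^j ≤ V^j for all j. -/
theorem scheme_comparison
    (n : ℕ) (hn : 1 ≤ n) (s Cs : ℝ) (hs : s ∈ Ioo (1/2 : ℝ) 1) (hCs : 0 < Cs)
    (ε τ : ℝ) (hε : 0 < ε) (hτ : 0 < τ) (hCFL : τ ≤ s * ε ^ (2*s) / Cs)
    (u₀ v₀ : E n → ℝ)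
    (hu₀b : ∃ M, ∀ z, |u₀ z| ≤ M) (hu₀c : UniformContinuous u₀)
    (hv₀b : ∃ M, ∀ z, |v₀ z| ≤ M) (hv₀c : UniformContinuous v₀)
    (U V : ℕ → E n → ℝ)
    (hUb : ∀ j, ∃ M, ∀ z, |U j z| ≤ M) (hUc : ∀ j, Continuous (U j))
    (hVb : ∀ j, ∃ M, ∀ z, |V j z| ≤ M) (hVc : ∀ j, Continuous (V j))
    (hU0 : U 0 = u₀) (hV0 : V 0 = v₀)
    (hUsub : ∀ j x, U (j+1) x ≤ U j x + τ * iflTrunc n s Cs ε (U j) x)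
    (hVsuper : ∀ j x, V (j+1) x ≥ V j x + τ * iflTrunc n s Cs ε (V j) x)
    (hinit : ∀ x, u₀ x ≤ v₀ x) :
    ∀ j x, U j x ≤ V j x := by
  intro j
  induction j with
  | zero => simpa only [hU0, hV0] using hinit
  | succ j ih =>
    intro x
    obtain ⟨A, hA⟩ := hUb j
    obtain ⟨B, hB⟩ := hVb j
    exact (hUsub j x).trans <| (add_mul_iflTrunc_mono hn (by linarith [hs.1]) hCs hε hτ hCFL
      hA (hUc j) hB (hVc j) ih x).trans (hVsuper j x)
end
end

section
/- Let n ≥ 1, s ∈ (1/2,1), C_s > 0, ε, τ > 0 with τ ≤ s ε^{2s}/C_s. Let u₀, v₀: ℝⁿ → ℝ be bounded and uniformly continuous, and let (U^j) and (V^j) be the solutions of the semi-discrete scheme with initial data u₀ and v₀ respectively. Then for every j ∈ ℕ, sup_{x∈ℝⁿ} |U^j(x) − V^j(x)| ≤ sup_{x∈ℝⁿ} |u₀(x) − v₀(x)| (sup-norm contraction). -/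
open MeasureTheory Metric Set

noncomputable section

/-- The operator inside the supremum and infimum of `iflTrunc`. -/
def iflIntegral {n : ℕ} (s ε : ℝ) (φ : E n → ℝ) (x y yt : E n) : ℝ :=
  ∫ η in Ioi ε, (φ (x + η • y) + φ (x - η • yt) - 2 * φ x) / η ^ (1 + 2*s)

/-- One explicit Euler step of the semi-discrete scheme. -/
def schemeStep (n : ℕ) (s Cs ε τ : ℝ) (φ : E n → ℝ) (x : E n) : ℝ :=
  φ x + τ * iflTrunc n s Cs ε φ x

lemma integrableOn_Ioi_inv_rpow {s ε : ℝ} (hs : 0 < s) (hε : 0 < ε) :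
    IntegrableOn (fun η : ℝ => (η ^ (1 + 2*s))⁻¹) (Ioi ε) := by
  refine (integrableOn_Ioi_rpow_of_lt (a := -(1 + 2*s)) (by linarith) hε).congr_fun
    (fun η hη => ?_) measurableSet_Ioi
  exact Real.rpow_neg (hε.trans hη).le _

lemma integral_Ioi_inv_rpow {s ε : ℝ} (hs : 0 < s) (hε : 0 < ε) :
    ∫ η in Ioi ε, (η ^ (1 + 2*s))⁻¹ = (2 * s * ε ^ (2*s))⁻¹ := by
  have h : ∫ η in Ioi ε, (η ^ (1 + 2*s))⁻¹ = ∫ η in Ioi ε, η ^ (-(1 + 2*s)) :=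
    setIntegral_congr_fun measurableSet_Ioi
      (fun η hη => (Real.rpow_neg (hε.trans hη).le _).symm)
  rw [h, integral_Ioi_rpow_of_lt (by linarith) hε,
    show -(1 + 2*s) + 1 = -(2*s) by ring, Real.rpow_neg hε.le, neg_div_neg_eq, mul_inv,
    div_eq_mul_inv, mul_comm]

lemma integrableOn_iflIntegrand {n : ℕ} {s ε M : ℝ} (hs : 0 < s) (hε : 0 < ε) {φ : E n → ℝ}
    (hφ : Continuous φ) (hM : ∀ z, |φ z| ≤ M) (x y yt : E n) :
    IntegrableOn
      (fun η : ℝ => (φ (x + η • y) + φ (x - η • yt) - 2 * φ x) / η ^ (1 + 2*s)) (Ioi ε) := by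
  simp only [div_eq_mul_inv]
  refine Integrable.bdd_mul (c := 4 * M) (integrableOn_Ioi_inv_rpow hs hε)
    (Continuous.aestronglyMeasurable (by fun_prop)) (Filter.Eventually.of_forall fun η => ?_)
  have h1 := abs_le.1 (hM (x + η • y))
  have h2 := abs_le.1 (hM (x - η • yt))
  have h3 := abs_le.1 (hM x)
  exact abs_le.2 ⟨by linarith, by linarith⟩

lemma iflIntegral_le_add {n : ℕ} {s ε M D : ℝ} (hs : 0 < s) (hε : 0 < ε) {φ ψ : E n → ℝ}
    (hφ : Continuous φ) (hψ : Continuous ψ) (hφM : ∀ z, |φ z| ≤ M) (hψM : ∀ z, |ψ z| ≤ M)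
    (hD : ∀ z, φ z - ψ z ≤ D) (x y yt : E n) :
    iflIntegral s ε φ x y yt ≤
      iflIntegral s ε ψ x y yt + (s * ε ^ (2*s))⁻¹ * (D - (φ x - ψ x)) := by
  have hK : (s * ε ^ (2*s))⁻¹ * (D - (φ x - ψ x)) =
      ∫ η in Ioi ε, 2 * (D - (φ x - ψ x)) * (η ^ (1 + 2*s))⁻¹ := by
    rw [integral_const_mul, integral_Ioi_inv_rpow hs hε]
    have := (Real.rpow_pos_of_pos hε (2*s)).ne'
    field_simp
  have hw := (integrableOn_Ioi_inv_rpow hs hε).const_mul (2 * (D - (φ x - ψ x)))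
  have hψi := integrableOn_iflIntegrand hs hε hψ hψM x y yt
  rw [hK, iflIntegral, iflIntegral, ← integral_add hψi hw]
  refine setIntegral_mono_on (integrableOn_iflIntegrand hs hε hφ hφM x y yt) (hψi.add hw)
    measurableSet_Ioi fun η hη => ?_
  have hp : 0 ≤ (η ^ (1 + 2*s))⁻¹ := inv_nonneg.2 (Real.rpow_nonneg (hε.trans hη).le _)
  rw [div_eq_mul_inv, div_eq_mul_inv, ← add_mul]
  refine mul_le_mul_of_nonneg_right ?_ hp
  linarith [hD (x + η • y), hD (x - η • yt)]

lemma iflIntegral_zero {n : ℕ} (s ε : ℝ) (x y yt : E n) :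
    iflIntegral s ε (fun _ => 0) x y yt = 0 := by
  simp [iflIntegral]

lemma exists_abs_iflIntegral_le {n : ℕ} {s ε M : ℝ} (hs : 0 < s) (hε : 0 < ε) {φ : E n → ℝ}
    (hφ : Continuous φ) (hM : ∀ z, |φ z| ≤ M) (x : E n) :
    ∃ B, ∀ y yt, |iflIntegral s ε φ x y yt| ≤ B := by
  have h0 : ∀ z : E n, |(fun _ : E n => (0 : ℝ)) z| ≤ M := fun z => by
    simpa using (abs_nonneg _).trans (hM z)
  have hp : 0 ≤ (s * ε ^ (2*s))⁻¹ := by positivity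
  have h3 := abs_le.1 (hM x)
  refine ⟨(s * ε ^ (2*s))⁻¹ * (2 * M), fun y yt => abs_le.2 ⟨?_, ?_⟩⟩
  · have h := iflIntegral_le_add hs hε continuous_const hφ h0 hM (D := M)
      (fun z => by linarith [abs_le.1 (hM z)]) x y yt
    rw [iflIntegral_zero] at h
    have := mul_le_mul_of_nonneg_left (show M - (0 - φ x) ≤ 2 * M by linarith) hp
    linarith
  · have h := iflIntegral_le_add hs hε hφ continuous_const hM h0 (D := M)
      (fun z => by linarith [abs_le.1 (hM z)]) x y yt
    rw [iflIntegral_zero] at h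
    have := mul_le_mul_of_nonneg_left (show M - (φ x - 0) ≤ 2 * M by linarith) hp
    linarith

lemma ciSup_ciInf_le_add {ι κ : Type*} [Nonempty ι] [Nonempty κ] {F G : ι → κ → ℝ} {B c : ℝ}
    (hF : ∀ i k, |F i k| ≤ B) (hG : ∀ i k, |G i k| ≤ B) (hFG : ∀ i k, F i k ≤ G i k + c) :
    ⨆ i, ⨅ k, F i k ≤ (⨆ i, ⨅ k, G i k) + c := by
  have hbdd : ∀ H : ι → κ → ℝ, (∀ i k, |H i k| ≤ B) → ∀ i, BddBelow (range (H i)) := by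
    rintro H hH i
    exact ⟨-B, by rintro _ ⟨k, rfl⟩; exact (abs_le.1 (hH i k)).1⟩
  have hGa : BddAbove (range fun i => ⨅ k, G i k) := by
    refine ⟨B, ?_⟩
    rintro _ ⟨i, rfl⟩
    exact (ciInf_le (hbdd G hG i) (Classical.arbitrary κ)).trans (abs_le.1 (hG i _)).2
  refine ciSup_le fun i => ?_
  have h1 : (⨅ k, F i k) - c ≤ ⨅ k, G i k :=
    le_ciInf fun k => by linarith [ciInf_le (hbdd F hF i) k, hFG i k]
  linarith [le_ciSup hGa i]

lemma iflTrunc_eq {n : ℕ} (s Cs ε : ℝ) (φ : E n → ℝ) (x : E n) :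
    iflTrunc n s Cs ε φ x = Cs * ⨆ y : {y : E n // ‖y‖ = 1}, ⨅ yt : {y : E n // ‖y‖ = 1},
      iflIntegral s ε φ x y yt := rfl

lemma schemeStep_sub_le {n : ℕ} (hn : 1 ≤ n) {s Cs ε τ M N D : ℝ} (hs : 0 < s) (hCs : 0 < Cs)
    (hε : 0 < ε) (hτ : 0 < τ) (hCFL : τ ≤ s * ε ^ (2*s) / Cs) {φ ψ : E n → ℝ}
    (hφ : Continuous φ) (hψ : Continuous ψ) (hφM : ∀ z, |φ z| ≤ M) (hψN : ∀ z, |ψ z| ≤ N)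
    (hD : ∀ z, φ z - ψ z ≤ D) (x : E n) :
    schemeStep n s Cs ε τ φ x - schemeStep n s Cs ε τ ψ x ≤ D := by
  have : Nonempty {y : E n // ‖y‖ = 1} :=
    ⟨⟨EuclideanSpace.single ⟨0, hn⟩ 1, by simp⟩⟩
  obtain ⟨A, hA⟩ := exists_abs_iflIntegral_le hs hε hφ hφM x
  obtain ⟨B, hB⟩ := exists_abs_iflIntegral_le hs hε hψ hψN x
  have key := ciSup_ciInf_le_add
    (F := fun y yt : {y : E n // ‖y‖ = 1} => iflIntegral s ε φ x y yt)
    (G := fun y yt : {y : E n // ‖y‖ = 1} => iflIntegral s ε ψ x y yt)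
    (fun y yt => (hA y yt).trans (le_max_left A B))
    (fun y yt => (hB y yt).trans (le_max_right A B))
    (fun y yt => iflIntegral_le_add hs hε hφ hψ (fun z => (hφM z).trans (le_max_left M N))
      (fun z => (hψN z).trans (le_max_right M N)) hD x y yt)
  have hP : 0 < s * ε ^ (2*s) := by positivity
  have hθ : τ * Cs * (s * ε ^ (2*s))⁻¹ ≤ 1 := by
    rw [← div_eq_mul_inv, div_le_one hP]
    exact (le_div_iff₀ hCs).1 hCFL
  have h1 := mul_le_mul_of_nonneg_left key (mul_pos hτ hCs).le
  have h2 := mul_le_mul_of_nonneg_right hθ (sub_nonneg.2 (hD x))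
  simp only [schemeStep, iflTrunc_eq]
  linarith

lemma abs_schemeStep_sub_le {n : ℕ} (hn : 1 ≤ n) {s Cs ε τ M N D : ℝ} (hs : 0 < s)
    (hCs : 0 < Cs) (hε : 0 < ε) (hτ : 0 < τ) (hCFL : τ ≤ s * ε ^ (2*s) / Cs) {φ ψ : E n → ℝ}
    (hφ : Continuous φ) (hψ : Continuous ψ) (hφM : ∀ z, |φ z| ≤ M) (hψN : ∀ z, |ψ z| ≤ N)
    (hD : ∀ z, |φ z - ψ z| ≤ D) (x : E n) :
    |schemeStep n s Cs ε τ φ x - schemeStep n s Cs ε τ ψ x| ≤ D := by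
  rw [abs_sub_le_iff]
  exact ⟨schemeStep_sub_le hn hs hCs hε hτ hCFL hφ hψ hφM hψN
      (fun z => (abs_sub_le_iff.1 (hD z)).1) x,
    schemeStep_sub_le hn hs hCs hε hτ hCFL hψ hφ hψN hφM
      (fun z => (abs_sub_le_iff.1 (hD z)).2) x⟩

lemma schemeStep_translate (n : ℕ) (s Cs ε τ : ℝ) (φ : E n → ℝ) (h x : E n) :
    schemeStep n s Cs ε τ (fun z => φ (z + h)) x = schemeStep n s Cs ε τ φ (x + h) := by
  simp only [schemeStep, iflTrunc, add_right_comm x _ h, sub_add_eq_add_sub]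

lemma abs_schemeStep_le {n : ℕ} (hn : 1 ≤ n) {s Cs ε τ M : ℝ} (hs : 0 < s)
    (hCs : 0 < Cs) (hε : 0 < ε) (hτ : 0 < τ) (hCFL : τ ≤ s * ε ^ (2*s) / Cs) {φ : E n → ℝ}
    (hφ : Continuous φ) (hM : ∀ z, |φ z| ≤ M) (x : E n) :
    |schemeStep n s Cs ε τ φ x| ≤ M := by
  have h := abs_schemeStep_sub_le hn hs hCs hε hτ hCFL hφ continuous_const hM (N := 0)
    (ψ := fun _ => 0) (by simp) (by simpa using hM) x
  simpa [schemeStep, iflTrunc] using h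

lemma uniformContinuous_schemeStep {n : ℕ} (hn : 1 ≤ n) {s Cs ε τ M : ℝ} (hs : 0 < s)
    (hCs : 0 < Cs) (hε : 0 < ε) (hτ : 0 < τ) (hCFL : τ ≤ s * ε ^ (2*s) / Cs) {φ : E n → ℝ}
    (hφ : UniformContinuous φ) (hM : ∀ z, |φ z| ≤ M) :
    UniformContinuous (schemeStep n s Cs ε τ φ) := by
  rw [Metric.uniformContinuous_iff_le] at hφ ⊢
  have hc : Continuous φ := (Metric.uniformContinuous_iff_le.2 hφ).continuous
  intro r hr
  obtain ⟨δ, hδ, H⟩ := hφ r hr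
  refine ⟨δ, hδ, fun a b hab => ?_⟩
  have h := abs_schemeStep_sub_le hn hs hCs hε hτ hCFL (φ := fun z => φ (z + (a - b)))
    (by fun_prop) hc (fun z => hM _) hM
    (fun z => H (a := z + (a - b)) (b := z) (by simpa [dist_eq_norm] using hab)) b
  rwa [schemeStep_translate, add_sub_cancel] at h

/-- sup-norm contraction for the semi-discrete scheme under the CFL condition:
`sup_x |U^j(x) − V^j(x)| ≤ sup_x |u₀(x) − v₀(x)|` for all j. -/
theorem scheme_contraction
    (n : ℕ) (hn : 1 ≤ n) (s Cs : ℝ) (hs : s ∈ Ioo (1/2 : ℝ) 1) (hCs : 0 < Cs)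
    (ε τ : ℝ) (hε : 0 < ε) (hτ : 0 < τ) (hCFL : τ ≤ s * ε ^ (2*s) / Cs)
    (u₀ v₀ : E n → ℝ)
    (hu₀b : ∃ M, ∀ z, |u₀ z| ≤ M) (hu₀c : UniformContinuous u₀)
    (hv₀b : ∃ M, ∀ z, |v₀ z| ≤ M) (hv₀c : UniformContinuous v₀)
    (U V : ℕ → E n → ℝ) (hU0 : U 0 = u₀) (hV0 : V 0 = v₀)
    (hUrec : ∀ j x, U (j+1) x = U j x + τ * iflTrunc n s Cs ε (U j) x)
    (hVrec : ∀ j x, V (j+1) x = V j x + τ * iflTrunc n s Cs ε (V j) x) :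
    ∀ j x, |U j x - V j x| ≤ ⨆ z, |u₀ z - v₀ z| := by
  have hs0 : 0 < s := by linarith [hs.1]
  have hregular : ∀ (w : E n → ℝ) (W : ℕ → E n → ℝ), (∃ M, ∀ z, |w z| ≤ M) →
      UniformContinuous w → W 0 = w →
      (∀ j x, W (j+1) x = W j x + τ * iflTrunc n s Cs ε (W j) x) →
      ∀ j, (∃ M, ∀ z, |W j z| ≤ M) ∧ UniformContinuous (W j) := by
    intro w W hb hc h0 hrec j
    induction j with
    | zero => exact h0 ▸ ⟨hb, hc⟩
    | succ j ih =>
      obtain ⟨⟨M, hM⟩, hu⟩ := ih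
      have hW : W (j+1) = schemeStep n s Cs ε τ (W j) := funext (hrec j)
      rw [hW]
      exact ⟨⟨M, abs_schemeStep_le hn hs0 hCs hε hτ hCFL hu.continuous hM⟩,
        uniformContinuous_schemeStep hn hs0 hCs hε hτ hCFL hu hM⟩
  intro j
  induction j with
  | zero =>
    obtain ⟨M, hM⟩ := hu₀b
    obtain ⟨N, hN⟩ := hv₀b
    intro x
    rw [hU0, hV0]
    refine le_ciSup (f := fun z => |u₀ z - v₀ z|) ⟨M + N, ?_⟩ x
    rintro _ ⟨z, rfl⟩
    exact (abs_sub _ _).trans (add_le_add (hM z) (hN z))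
  | succ j ih =>
    obtain ⟨⟨M, hM⟩, hUc⟩ := hregular u₀ U hu₀b hu₀c hU0 hUrec j
    obtain ⟨⟨N, hN⟩, hVc⟩ := hregular v₀ V hv₀b hv₀c hV0 hVrec j
    intro x
    rw [hUrec, hVrec]
    exact abs_schemeStep_sub_le hn hs0 hCs hε hτ hCFL hUc.continuous hVc.continuous hM hN ih x
end
end

section
/- Let s ∈ (1/2,1) and C_s > 0. For R > 1 let φ: ℝ² → ℝ be the indicator function of the annulus {z ∈ ℝ² : R−1 ≤ |z| ≤ R+1}, let x₀ := (R,0), and let Φ: ℝ → ℝ be the indicator function of {r ∈ ℝ : R−1 ≤ |r| ≤ R+1} (the even radial profile). Then: (i) C_s · sup_{|y|=1} ∫₀^∞ (φ(x₀+ηy) − φ(x₀)) η^{−1−2s} dη + C_s · inf_{|y|=1} ∫₀^∞ (φ(x₀−ηy) − φ(x₀)) η^{−1−2s} dη ≥ −(C_s/(2s)) · ((2R+1)^{−s} + 1); (ii) C_s ∫₀^∞ (Φ(R+η) + Φ(R−η) − 2Φ(R)) η^{−1−2s} dη = −(C_s/(2s)) · (2 + (2R+1)^{−2s} − (2R−1)^{−2s});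 and hence (iii) there exists R₀ > 1 such that for all R ≥ R₀ the quantity in (i) is strictly greater than the quantity in (ii). In particular, for radial functions that are not radially nonincreasing, the infinity fractional Laplacian need not coincide with the one-dimensional fractional Laplacian of the radial profile. -/
open MeasureTheory Metric Set

noncomputable section

abbrev E2 : Type := EuclideanSpace ℝ (Fin 2)

/-- Indicator of the annulus {z ∈ ℝ² : R−1 ≤ |z| ≤ R+1}. -/
def annφ (R : ℝ) : E2 → ℝ := fun z => if R - 1 ≤ ‖z‖ ∧ ‖z‖ ≤ R + 1 then 1 else 0

/-- The even radial profile: indicator of {r ∈ ℝ : R−1 ≤ |r| ≤ R+1}. -/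
def annΦ (R : ℝ) : ℝ → ℝ := fun r => if R - 1 ≤ |r| ∧ |r| ≤ R + 1 then 1 else 0

/-- The point x₀ = (R,0). -/
def basePt (R : ℝ) : E2 := (WithLp.equiv 2 (Fin 2 → ℝ)).symm ![R, 0]

/-- `C_s ⋅ sup_{|y|=1} ∫₀^∞ (φ(x₀+ηy) − φ(x₀)) η^{−1−2s} dη` for the annulus indicator. -/
def supPart (s Cs R : ℝ) : ℝ :=
  Cs * ⨆ y : {y : E2 // ‖y‖ = 1},
    ∫ η in Ioi (0:ℝ), (annφ R (basePt R + η • (y : E2)) - annφ R (basePt R)) / η ^ (1 + 2*s)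

/-- `C_s ⋅ inf_{|y|=1} ∫₀^∞ (φ(x₀−ηy) − φ(x₀)) η^{−1−2s} dη` for the annulus indicator. -/
def infPart (s Cs R : ℝ) : ℝ :=
  Cs * ⨅ y : {y : E2 // ‖y‖ = 1},
    ∫ η in Ioi (0:ℝ), (annφ R (basePt R - η • (y : E2)) - annφ R (basePt R)) / η ^ (1 + 2*s)

/-- Minus the one-dimensional fractional Laplacian of the radial profile at r = R. -/
def oneDPart (s Cs R : ℝ) : ℝ :=
  Cs * ∫ η in Ioi (0:ℝ), (annΦ R (R + η) + annΦ R (R - η) - 2 * annΦ R R) / η ^ (1 + 2*s)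

/-- The kernel `η^{-(1+2s)}` restricted to `(c, ∞)`. -/
def tailKernel (s c : ℝ) : ℝ → ℝ := (Ioi c).indicator fun η => η ^ (-(1 + 2 * s))

theorem tailKernel_nonneg {s c : ℝ} (hc : 0 < c) (η : ℝ) : 0 ≤ tailKernel s c η :=
  indicator_nonneg (fun _ hx => Real.rpow_nonneg (hc.trans hx).le _) η

theorem integrableOn_tailKernel {s c : ℝ} (hs : 0 < s) (hc : 0 < c) :
    IntegrableOn (tailKernel s c) (Ioi 0) := by
  refine Integrable.integrableOn ?_
  rw [tailKernel, integrable_indicator_iff measurableSet_Ioi]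
  exact integrableOn_Ioi_rpow_of_lt (by linarith) hc

theorem integral_tailKernel {s c : ℝ} (hs : 0 < s) (hc : 0 < c) :
    ∫ η in Ioi (0 : ℝ), tailKernel s c η = c ^ (-(2 * s)) / (2 * s) := by
  rw [tailKernel, setIntegral_indicator measurableSet_Ioi,
    inter_eq_right.2 (Ioi_subset_Ioi hc.le), integral_Ioi_rpow_of_lt (by linarith) hc]
  have h : -(1 + 2 * s) + 1 = -(2 * s) := by ring
  rw [h, neg_div_neg_eq]

theorem tailKernel_apply {s c η : ℝ} (hη : 0 < η) :
    tailKernel s c η = if c < η then 1 / η ^ (1 + 2 * s) else 0 := by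
  simp only [tailKernel, indicator_apply, mem_Ioi, Real.rpow_neg hη.le, one_div]

theorem norm_basePt {R : ℝ} (hR : 0 ≤ R) : ‖basePt R‖ = R := by
  simp [basePt, EuclideanSpace.norm_eq, Real.sqrt_sq hR]

theorem annφ_basePt {R : ℝ} (hR : 0 ≤ R) : annφ R (basePt R) = 1 := by
  simp [annφ, norm_basePt hR]

theorem annφ_le_one (R : ℝ) (z : E2) : annφ R z ≤ 1 := by
  unfold annφ; split_ifs <;> norm_num

theorem annφ_nonneg (R : ℝ) (z : E2) : 0 ≤ annφ R z := by
  unfold annφ; split_ifs <;> norm_num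

theorem annφ_basePt_sub {R : ℝ} (hR : 0 ≤ R) {v : E2} (hv : ‖v‖ ≤ 1) :
    annφ R (basePt R - v) = 1 := by
  have h₁ := norm_sub_norm_le (basePt R) v
  have h₂ := norm_sub_le (basePt R) v
  rw [norm_basePt hR] at h₁ h₂
  exact if_pos ⟨by linarith, by linarith⟩

theorem norm_basePt_add_vertical (R η : ℝ) :
    ‖basePt R + η • EuclideanSpace.single (1 : Fin 2) (1 : ℝ)‖ = √(R ^ 2 + η ^ 2) := by
  simp [basePt, EuclideanSpace.norm_eq]

theorem annφ_basePt_add_vertical {R η : ℝ} (hR : 1 ≤ R) (hη : 0 ≤ η) :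
    annφ R (basePt R + η • EuclideanSpace.single (1 : Fin 2) (1 : ℝ)) =
      if √(2 * R + 1) < η then 0 else 1 := by
  have h₁ : R - 1 ≤ √(R ^ 2 + η ^ 2) := Real.le_sqrt_of_sq_le (by nlinarith [sq_nonneg η])
  have h₂ : √(R ^ 2 + η ^ 2) ≤ R + 1 ↔ ¬ √(2 * R + 1) < η := by
    rw [Real.sqrt_le_left (by linarith), not_lt, Real.le_sqrt hη (by linarith)]
    constructor <;> intro h <;> nlinarith
  simp only [annφ, norm_basePt_add_vertical, h₁, h₂, true_and]
  split_ifs <;> simp_all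

theorem integral_vertical {s R : ℝ} (hs : 0 < s) (hR : 1 ≤ R) :
    ∫ η in Ioi (0 : ℝ), (annφ R (basePt R + η • EuclideanSpace.single (1 : Fin 2) (1 : ℝ)) -
      annφ R (basePt R)) / η ^ (1 + 2 * s) = -((2 * R + 1) ^ (-s) / (2 * s)) := by
  have hc : 0 < √(2 * R + 1) := Real.sqrt_pos.2 (by linarith)
  have hpow : √(2 * R + 1) ^ (-(2 * s)) = (2 * R + 1) ^ (-s) := by
    rw [Real.sqrt_eq_rpow, ← Real.rpow_mul (by linarith)]
    congr 1; ring
  rw [← hpow, ← integral_tailKernel hs hc, ← integral_neg]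
  refine setIntegral_congr_fun measurableSet_Ioi fun η hη => ?_
  have hη : 0 < η := hη
  simp only [annφ_basePt_add_vertical hR hη.le, annφ_basePt (zero_le_one.trans hR),
    tailKernel_apply hη]
  split_ifs <;> simp [neg_div]

theorem integral_add_nonpos {s R : ℝ} (hR : 0 ≤ R) (y : E2) :
    ∫ η in Ioi (0 : ℝ), (annφ R (basePt R + η • y) - annφ R (basePt R)) / η ^ (1 + 2 * s) ≤ 0 := by
  refine setIntegral_nonpos measurableSet_Ioi fun η hη => ?_
  have hη : 0 < η := hη
  rw [annφ_basePt hR]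
  exact div_nonpos_of_nonpos_of_nonneg (sub_nonpos.2 (annφ_le_one _ _)) (by positivity)

theorem le_integral_sub {s R : ℝ} (hs : 0 < s) (hR : 0 ≤ R) {y : E2} (hy : ‖y‖ = 1) :
    -(1 / (2 * s)) ≤
      ∫ η in Ioi (0 : ℝ), (annφ R (basePt R - η • y) - annφ R (basePt R)) / η ^ (1 + 2 * s) := by
  rw [neg_le, ← integral_neg]
  have h := integral_tailKernel hs one_pos
  rw [Real.one_rpow] at h
  rw [← h]
  refine integral_mono_of_nonneg ?_ (integrableOn_tailKernel hs one_pos) ?_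
  all_goals
    refine (ae_restrict_iff' measurableSet_Ioi).2 (.of_forall fun η hη => ?_)
    have hη : 0 < η := hη
    simp only [annφ_basePt hR, ← neg_div, neg_sub, Pi.zero_apply]
  · exact div_nonneg (sub_nonneg.2 (annφ_le_one _ _)) (by positivity)
  · rw [tailKernel_apply hη]
    split_ifs with h₁
    · have := annφ_nonneg R (basePt R - η • y)
      gcongr
      linarith
    · rw [annφ_basePt_sub hR, sub_self, zero_div]
      rw [norm_smul, hy, mul_one, Real.norm_of_nonneg hη.le]
      exact not_lt.1 h₁

theorem le_supPart {s Cs R : ℝ} (hs : 0 < s) (hCs : 0 ≤ Cs) (hR : 1 ≤ R) :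
    Cs * -((2 * R + 1) ^ (-s) / (2 * s)) ≤ supPart s Cs R := by
  refine mul_le_mul_of_nonneg_left ?_ hCs
  rw [← integral_vertical hs hR]
  exact le_ciSup (f := fun y : {y : E2 // ‖y‖ = 1} => ∫ η in Ioi (0 : ℝ),
      (annφ R (basePt R + η • (y : E2)) - annφ R (basePt R)) / η ^ (1 + 2 * s))
    ⟨0, forall_mem_range.2 fun y => integral_add_nonpos (zero_le_one.trans hR) y⟩
    ⟨EuclideanSpace.single (1 : Fin 2) (1 : ℝ), by simp⟩

theorem le_infPart {s Cs R : ℝ} (hs : 0 < s) (hCs : 0 ≤ Cs) (hR : 0 ≤ R) :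
    Cs * -(1 / (2 * s)) ≤ infPart s Cs R := by
  refine mul_le_mul_of_nonneg_left ?_ hCs
  have : Nonempty {y : E2 // ‖y‖ = 1} := ⟨⟨EuclideanSpace.single (1 : Fin 2) (1 : ℝ), by simp⟩⟩
  exact le_ciInf fun y => le_integral_sub hs hR y.2

theorem le_supPart_add_infPart {s Cs R : ℝ} (hs : 0 < s) (hCs : 0 ≤ Cs) (hR : 1 ≤ R) :
    -(Cs / (2 * s)) * ((2 * R + 1) ^ (-s) + 1) ≤ supPart s Cs R + infPart s Cs R :=
  calc -(Cs / (2 * s)) * ((2 * R + 1) ^ (-s) + 1)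
      = Cs * -((2 * R + 1) ^ (-s) / (2 * s)) + Cs * -(1 / (2 * s)) := by ring
    _ ≤ _ := add_le_add (le_supPart hs hCs hR) (le_infPart hs hCs (zero_le_one.trans hR))

theorem annΦ_self {R : ℝ} (hR : 0 ≤ R) : annΦ R R = 1 := by
  simp [annΦ, abs_of_nonneg hR]

theorem annΦ_add {R η : ℝ} (hR : 0 ≤ R) (hη : 0 ≤ η) :
    annΦ R (R + η) = if 1 < η then 0 else 1 := by
  unfold annΦ
  rw [abs_of_nonneg (by linarith)]
  split_ifs <;> grind

theorem annΦ_sub {R η : ℝ} (hR : 1 < R) (hη : 0 ≤ η) (hne : η ≠ 2 * R - 1) :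
    annΦ R (R - η) = (if 1 < η then 0 else 1) + (if 2 * R - 1 < η then 1 else 0)
      - (if 2 * R + 1 < η then 1 else 0) := by
  unfold annΦ
  rcases abs_cases (R - η) with ⟨h, _⟩ | ⟨h, _⟩ <;> rw [h] <;> split_ifs <;> grind

theorem oneDPart_eq {s R : ℝ} (Cs : ℝ) (hs : 0 < s) (hR : 1 < R) :
    oneDPart s Cs R =
      -(Cs / (2 * s)) * (2 + (2 * R + 1) ^ (-(2 * s)) - (2 * R - 1) ^ (-(2 * s))) := by
  have h₁ := integrableOn_tailKernel hs one_pos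
  have h₂ := integrableOn_tailKernel hs (c := 2 * R - 1) (by linarith)
  have h₃ := integrableOn_tailKernel hs (c := 2 * R + 1) (by linarith)
  have h₁₂ : IntegrableOn (fun η => -2 * tailKernel s 1 η + tailKernel s (2 * R - 1) η) (Ioi 0) :=
    (h₁.const_mul _).add h₂
  have key : ∫ η in Ioi (0 : ℝ), (annΦ R (R + η) + annΦ R (R - η) - 2 * annΦ R R) / η ^ (1 + 2 * s)
      = ∫ η in Ioi (0 : ℝ),
        (-2 * tailKernel s 1 η + tailKernel s (2 * R - 1) η - tailKernel s (2 * R + 1) η) := by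
    refine setIntegral_congr_ae measurableSet_Ioi ?_
    filter_upwards [Measure.ae_ne volume (2 * R - 1)] with η hne hη
    have hη : 0 < η := hη
    rw [annΦ_self (by linarith), annΦ_add (by linarith) hη.le, annΦ_sub hR hη.le hne,
      tailKernel_apply hη, tailKernel_apply hη, tailKernel_apply hη]
    split_ifs <;> ring
  rw [oneDPart, key, integral_sub h₁₂ h₃, integral_add (h₁.const_mul _) h₂,
    integral_const_mul, integral_tailKernel hs one_pos, integral_tailKernel hs (by linarith),
    integral_tailKernel hs (by linarith), Real.one_rpow]
  ring

theorem rpow_neg_lt_half {x t : ℝ} (hx : 4 < x) (ht : 1 / 2 ≤ t) : x ^ (-t) < 1 / 2 :=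
  calc x ^ (-t) ≤ x ^ (-(1 / 2) : ℝ) := Real.rpow_le_rpow_of_exponent_le (by linarith) (by linarith)
    _ < 4 ^ (-(1 / 2) : ℝ) := Real.rpow_lt_rpow_of_neg (by norm_num) hx (by norm_num)
    _ = 1 / 2 := by
      rw [show (4 : ℝ) = 2 ^ (2 : ℝ) by norm_num, ← Real.rpow_mul (by norm_num)]
      norm_num [Real.rpow_neg_one]

/-- counterexample showing that for radial functions that are not radially
nonincreasing, the infinity fractional Laplacian need not coincide with the one-dimensional
fractional Laplacian of the radial profile. -/
theorem annulus_counterexample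
    (s Cs : ℝ) (hs : s ∈ Ioo (1/2 : ℝ) 1) (hCs : 0 < Cs) :
    (∀ R : ℝ, 1 < R →
      supPart s Cs R + infPart s Cs R ≥ -(Cs / (2*s)) * ((2*R + 1) ^ (-s) + 1)) ∧
    (∀ R : ℝ, 1 < R →
      oneDPart s Cs R = -(Cs / (2*s)) * (2 + (2*R + 1) ^ (-(2*s)) - (2*R - 1) ^ (-(2*s)))) ∧
    (∃ R₀ : ℝ, 1 < R₀ ∧ ∀ R : ℝ, R₀ ≤ R →
      supPart s Cs R + infPart s Cs R > oneDPart s Cs R) := by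
  have hs₀ : 0 < s := by linarith [hs.1]
  refine ⟨fun R hR => le_supPart_add_infPart hs₀ hCs.le hR.le,
    fun R hR => oneDPart_eq Cs hs₀ hR, 4, by norm_num, fun R hR => ?_⟩
  refine lt_of_lt_of_le ?_ (le_supPart_add_infPart hs₀ hCs.le (by linarith))
  rw [oneDPart_eq Cs hs₀ (by linarith)]
  have h₁ : (2 * R + 1) ^ (-s) < 1 / 2 := rpow_neg_lt_half (by linarith) hs.1.le
  have h₂ : (2 * R - 1) ^ (-(2 * s)) < 1 / 2 := rpow_neg_lt_half (by linarith) (by linarith [hs.1])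
  have h₃ : 0 < (2 * R + 1) ^ (-(2 * s)) := Real.rpow_pos_of_pos (by linarith) _
  exact mul_lt_mul_of_neg_left (by linarith) (neg_neg_of_pos (by positivity))
end
end
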